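/- Let k₀, …, kₙ ∈ {0,1,2,3}, let τ = r_{k₀}(r_{k₁}(⋯ r_{kₙ}(1²2¹)⋯)), and write σ_{k₀}σ_{k₁}⋯σ_{kₙ}·(1,0)ᵀ = (a+bφ, c+dφ)ᵀ with a, b, c, d natural numbers (such a, b, c, d exist and are unique since φ is irrational). Then (a_τ, b_τ, c_τ, d_τ) = (2a, 2b, 2c, 2d). -/

import Mathlib

noncomputable section
open Matrix

noncomputable def φ : ℝ := (1 + Real.sqrt 5) / 2

noncomputable def σ : Fin 4 → Matrix (Fin 2) (Fin 2) ℝ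
  | 0 => !![1, φ; 0, 1]
  | 1 => !![φ, φ; 1, φ]
  | 2 => !![φ, 1; φ, φ]
  | 3 => !![1, 0; φ, 1]

inductive B : Type
  | l12 | l21 | l23 | l32 | l34 | l43 | l45 | l54
  deriving DecidableEq, BEq, Repr

open B

/-- The substitutions r₀, r₁, r₂, r₃ on the 8-letter alphabet B,
where `l12` denotes the letter 1², etc. -/
def r : Fin 4 → B → List B
  | 0, l12 => [l21]
  | 0, l21 => [l12]
  | 0, l23 => [l12, l23, l34]
  | 0, l32 => [l43, l32, l21]
  | 0, l34 => [l43]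
  | 0, l43 => [l34]
  | 0, l45 => [l34, l45]
  | 0, l54 => [l54, l43]
  | 1, l12 => [l34, l45]
  | 1, l21 => [l54, l43]
  | 1, l23 => [l54, l43, l32, l21]
  | 1, l32 => [l12, l23, l34, l45]
  | 1, l34 => [l12, l23, l34]
  | 1, l43 => [l43, l32, l21]
  | 1, l45 => [l43, l32]
  | 1, l54 => [l23, l34]
  | 2, l12 => [l43, l32]
  | 2, l21 => [l23, l34]
  | 2, l23 => [l23, l34, l45]
  | 2, l32 => [l54, l43, l32]
  | 2, l34 => [l54, l43, l32, l21]
  | 2, l43 => [l12, l23, l34, l45]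
  | 2, l45 => [l12, l23]
  | 2, l54 => [l32, l21]
  | 3, l12 => [l12, l23]
  | 3, l21 => [l32, l21]
  | 3, l23 => [l32]
  | 3, l32 => [l23]
  | 3, l34 => [l23, l34, l45]
  | 3, l43 => [l54, l43, l32]
  | 3, l45 => [l54]
  | 3, l54 => [l45]

/-- Applying the substitution rᵢ letter by letter to a word. -/
def subst (i : Fin 4) (w : List B) : List B := (w.map (r i)).flatten

/-- a_τ : number of letters in {1², 2¹}. -/
def na (w : List B) : ℕ := w.count l12 + w.count l21
/-- d_τ : number of letters in {2³, 3²}. -/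
def nd (w : List B) : ℕ := w.count l23 + w.count l32
/-- b_τ : number of letters in {3⁴, 4³}. -/
def nb (w : List B) : ℕ := w.count l34 + w.count l43
/-- c_τ : number of letters in {4⁵, 5⁴}. -/
def nc (w : List B) : ℕ := w.count l45 + w.count l54

theorem beq_aux (x y : B) : (x == y) = decide (x = y) := by
  cases x <;> cases y <;> rfl

theorem phi_sq_aux : φ * φ = φ + 1 := by
  have h5 : Real.sqrt 5 * Real.sqrt 5 = 5 := Real.mul_self_sqrt (by norm_num)
  unfold φ
  nlinarith

theorem phi_irr_aux : Irrational φ := Real.goldenRatio_irrational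

def vec_aux (w : List B) : Fin 2 → ℝ :=
  ![(na w : ℝ) + nb w * φ, (nc w : ℝ) + nd w * φ]

theorem vec_append_aux (u v : List B) : vec_aux (u ++ v) = vec_aux u + vec_aux v := by
  ext j
  fin_cases j <;> simp [vec_aux, na, nb, nc, nd, List.count_append] <;> ring

theorem vec_letter_aux (i : Fin 4) (x : B) :
    vec_aux (r i x) = (σ i).mulVec (vec_aux [x]) := by
  have e := phi_sq_aux
  have hn : ∀ w : List B, ∀ p q s t : ℕ, na w = p → nb w = q → nc w = s → nd w = t →
      vec_aux w = ![(p : ℝ) + q * φ, (s : ℝ) + t * φ] := by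
    intro w p q s t h1 h2 h3 h4
    simp [vec_aux, h1, h2, h3, h4]
  fin_cases i <;> cases x <;>
    (rw [hn (r _ _) _ _ _ _ rfl rfl rfl rfl, hn [_] _ _ _ _ rfl rfl rfl rfl]
     ext j
     fin_cases j <;>
       simp [r, σ, na, nb, nc, nd, Matrix.mulVec, dotProduct, Fin.sum_univ_two,
         List.count_cons, beq_aux] <;> try linarith)

theorem vec_subst_aux (i : Fin 4) (w : List B) :
    vec_aux (subst i w) = (σ i).mulVec (vec_aux w) := by
  induction w with
  | nil =>
    have h0 : vec_aux [] = 0 := by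
      ext j
      fin_cases j <;> simp [vec_aux, na, nb, nc, nd]
    simp [subst, h0]
  | cons x w ih =>
    have h1 : subst i (x :: w) = r i x ++ subst i w := by simp [subst]
    have h2 : x :: w = [x] ++ w := rfl
    rw [h1, h2, vec_append_aux, vec_append_aux, ih, vec_letter_aux, Matrix.mulVec_add]

theorem vec_foldr_aux (ks : List (Fin 4)) :
    vec_aux (ks.foldr subst [l12, l21]) = (ks.map σ).prod.mulVec (![2, 0]) := by
  induction ks with
  | nil =>
    ext j
    fin_cases j <;> simp [vec_aux, na, nb, nc, nd, List.count_cons, beq_aux] <;> norm_num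
  | cons k ks ih =>
    simp only [List.foldr_cons, List.map_cons, List.prod_cons]
    rw [vec_subst_aux, ih, Matrix.mulVec_mulVec]

theorem phi_unique_aux (p q s t : ℕ) (h : (p : ℝ) + q * φ = s + t * φ) : p = s ∧ q = t := by
  have hq : q = t := by
    by_contra hne
    have hne' : (q : ℝ) - t ≠ 0 := by
      intro h0
      exact hne (by exact_mod_cast sub_eq_zero.mp h0)
    apply phi_irr_aux
    refine ⟨((s : ℚ) - p) / ((q : ℚ) - t), ?_⟩
    push_cast
    rw [div_eq_iff hne']
    linarith
  subst hq
  exact ⟨by exact_mod_cast add_right_cancel h, rfl⟩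

theorem stmt14 (ks : List (Fin 4)) (a b c d : ℕ)
    (h : ((ks.map σ).prod).mulVec ![1, 0] = ![(a : ℝ) + b * φ, (c : ℝ) + d * φ])
    (τ : List B) (hτ : τ = ks.foldr subst [l12, l21]) :
    na τ = 2 * a ∧ nb τ = 2 * b ∧ nc τ = 2 * c ∧ nd τ = 2 * d := by
  have h2 : (![2, 0] : Fin 2 → ℝ) = (2 : ℝ) • ![1, 0] := by
    ext j
    fin_cases j <;> simp
  have hv := vec_foldr_aux ks
  rw [← hτ, h2, Matrix.mulVec_smul, h] at hv
  have e0 := congrFun hv 0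
  have e1 := congrFun hv 1
  simp [vec_aux] at e0 e1
  obtain ⟨ha, hb⟩ := phi_unique_aux (na τ) (nb τ) (2 * a) (2 * b) (by push_cast; linarith)
  obtain ⟨hc, hd⟩ := phi_unique_aux (nc τ) (nd τ) (2 * c) (2 * d) (by push_cast; linarith)
  exact ⟨ha, hb, hc, hd⟩
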